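/- (Inflation computation from Table 3, second column, case c1 < λ ≤ c1+c2, using negative inflation along F−E1−E2.) Let ℓ ≥ 1 be an integer and let λ, c1, c2 be real numbers with 0 < c2 < c1 < λ ≤ c1 + c2 and c1 + c2 < 1; set μ = ℓ + λ. For b ≥ 0 put e = (c1−c2)·b/(1−c1+c2), define the linear functional ω_{be} = (ω_{μ,c1,c2} + b·PD(D_{4ℓ+1}) + e·PD(D_{4ℓ+3}))/(1+b+e) on H, put a = c2·b/(1−c1+c2+b), and define ω_b = ω_{be} + a·PD(F−E1−E2). Then: (i) 2a < ω_{be}(F−E1−E2); (ii) ω_b(F) = 1, ω_b(E1) = c1, ω_b(E2) = c2; and (iii) ω_b(B) = (μ(1−c1+c2) + b(ℓ+c1))/(1−c1+c2+b). -/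

import Mathlib

/-- `H = ℤ⁴` with basis `B, F, E1, E2`. -/
def Bv : Fin 4 → ℤ := ![1, 0, 0, 0]
def Fv : Fin 4 → ℤ := ![0, 1, 0, 0]
def E1v : Fin 4 → ℤ := ![0, 0, 1, 0]
def E2v : Fin 4 → ℤ := ![0, 0, 0, 1]

/-- The intersection form: `Q(B,F) = 1`, `Q(B,B) = Q(F,F) = 0`,
`Q(E1,E1) = Q(E2,E2) = −1`, all other pairings of basis vectors zero. -/
def Qform (v w : Fin 4 → ℤ) : ℤ := v 0 * w 1 + v 1 * w 0 - v 2 * w 2 - v 3 * w 3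

/-- `PD A : H → ℤ`, `C ↦ Q(A, C)`. -/
def PD (A v : Fin 4 → ℤ) : ℤ := Qform A v

/-- The classes `D i`: `D (4k+1) = B + kF`, `D (4k) = B + kF − E2`,
`D (4k−1) = B + kF − E1`, `D (4k−2) = B + kF − E1 − E2`. -/
def Dcl (i : ℤ) : Fin 4 → ℤ :=
  if i % 4 = 0 then ![1, i / 4, 0, -1]
  else if i % 4 = 1 then ![1, (i - 1) / 4, 0, 0]
  else if i % 4 = 2 then ![1, (i + 2) / 4, -1, -1]
  else ![1, (i + 1) / 4, -1, 0]

/-- The area functional `ω_{μ,c1,c2}` with values `μ, 1, c1, c2` on `B, F, E1, E2`. -/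
noncomputable def omegaF (μ c1 c2 : ℝ) (v : Fin 4 → ℤ) : ℝ :=
  μ * (v 0 : ℝ) + (v 1 : ℝ) + c1 * (v 2 : ℝ) + c2 * (v 3 : ℝ)

/-- `ω_{be} = (ω_{μ,c1,c2} + b·PD(D_{4ℓ+1}) + e·PD(D_{4ℓ+3}))/(1+b+e)` with
`e = (c1−c2)·b/(1−c1+c2)`. -/
noncomputable def wbe (l : ℤ) (μ c1 c2 b : ℝ) (v : Fin 4 → ℤ) : ℝ :=
  (omegaF μ c1 c2 v + b * (PD (Dcl (4 * l + 1)) v : ℝ) +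
      ((c1 - c2) * b / (1 - c1 + c2)) * (PD (Dcl (4 * l + 3)) v : ℝ)) /
    (1 + b + (c1 - c2) * b / (1 - c1 + c2))

/-- `ω_b = ω_{be} + a·PD(F−E1−E2)` with `a = c2·b/(1−c1+c2+b)`. -/
noncomputable def wb (l : ℤ) (μ c1 c2 b : ℝ) (v : Fin 4 → ℤ) : ℝ :=
  wbe l μ c1 c2 b v + (c2 * b / (1 - c1 + c2 + b)) * (PD (Fv - E1v - E2v) v : ℝ)

/-- Inflation computation from Table 3, second column (case `c1 < λ ≤ c1+c2`,
negative inflation along `F−E1−E2`): for all `b ≥ 0`,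
(i) `2a < ω_{be}(F−E1−E2)`; (ii) `ω_b(F) = 1`, `ω_b(E1) = c1`, `ω_b(E2) = c2`;
(iii) `ω_b(B) = (μ(1−c1+c2) + b(ℓ+c1))/(1−c1+c2+b)`. -/
theorem statement15 (l : ℤ) (hl : 1 ≤ l) (lam c1 c2 μ : ℝ)
    (h0 : 0 < c2) (h1 : c2 < c1) (h2 : c1 < lam) (h3 : lam ≤ c1 + c2)
    (h4 : c1 + c2 < 1) (hμ : μ = (l : ℝ) + lam) :
    ∀ b : ℝ, 0 ≤ b →
      2 * (c2 * b / (1 - c1 + c2 + b)) < wbe l μ c1 c2 b (Fv - E1v - E2v) ∧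
      wb l μ c1 c2 b Fv = 1 ∧ wb l μ c1 c2 b E1v = c1 ∧ wb l μ c1 c2 b E2v = c2 ∧
      wb l μ c1 c2 b Bv = (μ * (1 - c1 + c2) + b * ((l : ℝ) + c1)) /
        (1 - c1 + c2 + b) := by
  intro b hb
  have hs : 0 < 1 - c1 + c2 := by linarith
  have hsb : 0 < 1 - c1 + c2 + b := by linarith
  have hden : 1 + b + (c1 - c2) * b / (1 - c1 + c2) =
      (1 - c1 + c2 + b) / (1 - c1 + c2) := by
    field_simp
    ring
  have hD1 : Dcl (4 * l + 1) = ![1, l, 0, 0] := by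
    have e1 : (4 * l + 1) % 4 = 1 := by omega
    have e2 : (4 * l + 1 - 1) / 4 = l := by omega
    simp only [Dcl, e1, e2]
    norm_num
  have hD3 : Dcl (4 * l + 3) = ![1, l + 1, -1, 0] := by
    have e1 : (4 * l + 3) % 4 = 3 := by omega
    have e2 : (4 * l + 3 + 1) / 4 = l + 1 := by omega
    simp only [Dcl, e1, e2]
    norm_num
  refine ⟨?_, ?_, ?_, ?_, ?_⟩
  · have key : wbe l μ c1 c2 b (Fv - E1v - E2v) =
        ((1 - c1 - c2 + b) * (1 - c1 + c2)) / (1 - c1 + c2 + b) := by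
      rw [wbe, hden, hD1, hD3]
      simp [omegaF, PD, Qform, Fv, E1v, E2v]
      field_simp
      ring
    rw [key, ← mul_div_assoc]
    apply div_lt_div_of_pos_right _ hsb
    nlinarith [mul_nonneg hb (by linarith : (0:ℝ) ≤ 1 - c1 - c2),
      mul_pos hs (by linarith : (0:ℝ) < 1 - c1 - c2)]
  all_goals
    rw [wb, wbe, hden, hD1, hD3]
    simp [omegaF, PD, Qform, Fv, E1v, E2v, Bv]
    field_simp
    try ring
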